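/- Third inequality of the chain relating success probabilities: for quantum channels N⁰ and N¹ from A (dimension d_A) to B (dimension d_B) with Kraus operators {N_k⁰}_{k=1}^K and {N_k¹}_{k=1}^K, it holds that p_inc(N⁰, N¹) ≤ √(p_coh(N⁰, N¹)). -/

import Mathlib

open scoped Kronecker Matrix ComplexOrder

/-- The ℓ²→ℓ² operator norm of a complex matrix. -/
noncomputable def opNorm {m n : Type*} [Fintype m] [Fintype n] [DecidableEq n]
    (M : Matrix m n ℂ) : ℝ :=
  ‖LinearMap.toContinuousLinearMap (Matrix.toEuclideanLin M)‖

/-- The extended adjoint `N†(P) = ∑ₖ (I ⊗ Nₖᴴ ⊗ I) P (I ⊗ Nₖ)` of a channel with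
Kraus operators `N k`, applied to a `(d_R·d_B·d_E') × (d_R·d_B)` matrix `P`. -/
noncomputable def chAdj {dA dB dR dE : ℕ} {ι : Type*} [Fintype ι]
    (N : ι → Matrix (Fin dB) (Fin dA) ℂ)
    (P : Matrix (Fin dR × Fin dB × Fin dE) (Fin dR × Fin dB) ℂ) :
    Matrix (Fin dR × Fin dA × Fin dE) (Fin dR × Fin dA) ℂ :=
  ∑ k, ((1 : Matrix (Fin dR) (Fin dR) ℂ) ⊗ₖ ((N k)ᴴ ⊗ₖ (1 : Matrix (Fin dE) (Fin dE) ℂ))) *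
    P * ((1 : Matrix (Fin dR) (Fin dR) ℂ) ⊗ₖ N k)

/-- The coherent-discrimination success probability
`p_coh(N⁰,N¹) = [ (1/2) · sup ‖ N⁰†(P⁰) + N¹†(P¹) ‖ ]²`, where the supremum is over all
positive integers `d_R, d_E'` and all matrices `P⁰, P¹` with `P⁰ᴴP⁰ + P¹ᴴP¹ = I`. -/
noncomputable def pcoh {dA dB : ℕ} {ι : Type*} [Fintype ι]
    (N0 N1 : ι → Matrix (Fin dB) (Fin dA) ℂ) : ℝ :=
  ((1/2) * sSup {x : ℝ | ∃ (dR dE : ℕ), 0 < dR ∧ 0 < dE ∧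
    ∃ P0 P1 : Matrix (Fin dR × Fin dB × Fin dE) (Fin dR × Fin dB) ℂ,
      P0ᴴ * P0 + P1ᴴ * P1 = 1 ∧ x = opNorm (chAdj N0 P0 + chAdj N1 P1)})^2

/-- The incoherent-discrimination success probability
`p_inc(N⁰,N¹) = (1/2) · sup ‖ ∑ₖ (I⊗N⁰ₖ)† Λ⁰ (I⊗N⁰ₖ) + ∑ₖ (I⊗N¹ₖ)† Λ¹ (I⊗N¹ₖ) ‖`,
supremum over positive integers `d_R` and positive semidefinite `Λ⁰, Λ¹` with `Λ⁰ + Λ¹ = I`. -/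
noncomputable def pinc {dA dB : ℕ} {ι : Type*} [Fintype ι]
    (N0 N1 : ι → Matrix (Fin dB) (Fin dA) ℂ) : ℝ :=
  (1/2) * sSup {x : ℝ | ∃ (dR : ℕ), 0 < dR ∧
    ∃ L0 L1 : Matrix (Fin dR × Fin dB) (Fin dR × Fin dB) ℂ,
      L0.PosSemidef ∧ L1.PosSemidef ∧ L0 + L1 = 1 ∧
      x = opNorm
        (∑ k, ((1 : Matrix (Fin dR) (Fin dR) ℂ) ⊗ₖ N0 k)ᴴ * L0 *
            ((1 : Matrix (Fin dR) (Fin dR) ℂ) ⊗ₖ N0 k) +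
         ∑ k, ((1 : Matrix (Fin dR) (Fin dR) ℂ) ⊗ₖ N1 k)ᴴ * L1 *
            ((1 : Matrix (Fin dR) (Fin dR) ℂ) ⊗ₖ N1 k))}

open scoped Matrix.Norms.L2Operator MatrixOrder

theorem opNorm_eq_norm {m n : Type*} [Fintype m] [Fintype n] [DecidableEq n]
    (M : Matrix m n ℂ) : opNorm M = ‖M‖ := (Matrix.l2_opNorm_def M).symm

theorem Matrix.l2_opNorm_one_le {n : Type*} [Fintype n] [DecidableEq n] :
    ‖(1 : Matrix n n ℂ)‖ ≤ 1 := by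
  have h := Matrix.l2_opNorm_conjTranspose_mul_self (1 : Matrix n n ℂ)
  rw [Matrix.conjTranspose_one, Matrix.one_mul] at h
  nlinarith [norm_nonneg (1 : Matrix n n ℂ)]

/-- A matrix with orthonormal columns is a contraction. -/
theorem Matrix.l2_opNorm_le_one_of_conjTranspose_mul_self {m n : Type*} [Fintype m] [Fintype n]
    [DecidableEq n] {A : Matrix m n ℂ} (hA : Aᴴ * A = 1) : ‖A‖ ≤ 1 := by
  have h := Matrix.l2_opNorm_conjTranspose_mul_self A
  rw [hA] at h
  nlinarith [norm_nonneg A, Matrix.l2_opNorm_one_le (n := n)]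

/-- Selecting rows along an injection does not increase the operator norm. -/
theorem Matrix.l2_opNorm_submatrix_id_le {l m n : Type*} [Fintype l] [Fintype m] [Fintype n]
    [DecidableEq l] [DecidableEq m] [DecidableEq n] (A : Matrix m n ℂ) {f : l → m}
    (hf : Function.Injective f) : ‖A.submatrix f id‖ ≤ ‖A‖ := by
  set S : Matrix l m ℂ := (1 : Matrix m m ℂ).submatrix f id
  have hSA : A.submatrix f id = S * A := by
    ext i j
    simp [S, Matrix.mul_apply, Matrix.one_apply]
  have hS : ‖S‖ ≤ 1 := by
    rw [← Matrix.l2_opNorm_conjTranspose]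
    refine Matrix.l2_opNorm_le_one_of_conjTranspose_mul_self ?_
    ext i j
    simp [S, Matrix.mul_apply, Matrix.one_apply, hf.eq_iff, eq_comm]
  calc ‖A.submatrix f id‖ = ‖S * A‖ := by rw [hSA]
    _ ≤ ‖S‖ * ‖A‖ := Matrix.l2_opNorm_mul S A
    _ ≤ ‖A‖ := mul_le_of_le_one_left (norm_nonneg A) hS

theorem Matrix.l2_opNorm_le_one_of_sum_conjTranspose_mul_self {ι m n : Type*} [Fintype ι]
    [DecidableEq ι] [Fintype m] [DecidableEq m] [Fintype n] [DecidableEq n]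
    {A : ι → Matrix m n ℂ} (hA : ∑ k, (A k)ᴴ * A k = 1) (k : ι) : ‖A k‖ ≤ 1 := by
  set V : Matrix (ι × m) n ℂ := Matrix.of fun i j => A i.1 i.2 j
  have hV : Vᴴ * V = 1 := by
    rw [← hA]
    ext i j
    simp [V, Matrix.mul_apply, Matrix.sum_apply, Fintype.sum_prod_type]
  have hAk : A k = V.submatrix (Prod.mk k) id := rfl
  rw [hAk]
  exact (Matrix.l2_opNorm_submatrix_id_le V (Prod.mk_right_injective k)).trans
    (Matrix.l2_opNorm_le_one_of_conjTranspose_mul_self hV)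

section Kraus

variable {dA dB : ℕ} {ι : Type*} [Fintype ι] {N : ι → Matrix (Fin dB) (Fin dA) ℂ}

theorem sum_one_kronecker_conjTranspose_mul_self {κ : Type*} [Fintype κ] [DecidableEq κ]
    (hN : ∑ k, (N k)ᴴ * N k = 1) :
    ∑ k, ((1 : Matrix κ κ ℂ) ⊗ₖ N k)ᴴ * ((1 : Matrix κ κ ℂ) ⊗ₖ N k) = 1 := by
  simp only [Matrix.conjTranspose_kronecker, ← Matrix.mul_kronecker_mul,
    Matrix.conjTranspose_one, Matrix.one_mul]
  rw [← Matrix.one_kronecker_one, ← hN]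
  ext i j
  simp [Matrix.sum_apply, Matrix.kroneckerMap_apply, Finset.mul_sum]

theorem norm_one_kronecker_le_one [DecidableEq ι] {κ : Type*} [Fintype κ] [DecidableEq κ]
    (hN : ∑ k, (N k)ᴴ * N k = 1) (k : ι) : ‖(1 : Matrix κ κ ℂ) ⊗ₖ N k‖ ≤ 1 :=
  Matrix.l2_opNorm_le_one_of_sum_conjTranspose_mul_self
    (sum_one_kronecker_conjTranspose_mul_self hN) k

theorem norm_one_kronecker_kronecker_one_le_one [DecidableEq ι] {κ μ : Type*} [Fintype κ]
    [DecidableEq κ] [Fintype μ] [DecidableEq μ] (hN : ∑ k, (N k)ᴴ * N k = 1) (k : ι) :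
    ‖(1 : Matrix κ κ ℂ) ⊗ₖ ((N k)ᴴ ⊗ₖ (1 : Matrix μ μ ℂ))‖ ≤ 1 := by
  have hN₁ : ∑ k, (N k ⊗ₖ (1 : Matrix μ μ ℂ))ᴴ * (N k ⊗ₖ (1 : Matrix μ μ ℂ)) = 1 := by
    simp only [Matrix.conjTranspose_kronecker, ← Matrix.mul_kronecker_mul,
      Matrix.conjTranspose_one, Matrix.one_mul]
    rw [← Matrix.one_kronecker_one, ← hN]
    ext i j
    simp [Matrix.sum_apply, Matrix.kroneckerMap_apply, Finset.sum_mul]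
  have h : ∑ k, ((1 : Matrix κ κ ℂ) ⊗ₖ (N k ⊗ₖ (1 : Matrix μ μ ℂ)))ᴴ *
      ((1 : Matrix κ κ ℂ) ⊗ₖ (N k ⊗ₖ (1 : Matrix μ μ ℂ))) = 1 := by
    simp only [Matrix.conjTranspose_kronecker _ (_ ⊗ₖ _), ← Matrix.mul_kronecker_mul,
      Matrix.conjTranspose_one, Matrix.one_mul]
    rw [← Matrix.one_kronecker_one, ← hN₁]
    ext i j
    simp only [Matrix.sum_apply, Matrix.kroneckerMap_apply, Finset.mul_sum]
  have hk := Matrix.l2_opNorm_le_one_of_sum_conjTranspose_mul_self h k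
  rw [← Matrix.l2_opNorm_conjTranspose] at hk
  simpa only [Matrix.conjTranspose_kronecker, Matrix.conjTranspose_one] using hk

theorem norm_chAdj_le [DecidableEq ι] {dR dE : ℕ} (hN : ∑ k, (N k)ᴴ * N k = 1)
    {P : Matrix (Fin dR × Fin dB × Fin dE) (Fin dR × Fin dB) ℂ} (hP : ‖P‖ ≤ 1) :
    ‖chAdj N P‖ ≤ Fintype.card ι := by
  rw [chAdj, ← nsmul_one, ← Finset.card_univ]
  refine norm_sum_le_of_le _ (fun k _ => ?_) |>.trans (Finset.sum_const _).le
  refine (Matrix.l2_opNorm_mul _ _).trans (mul_le_one₀ ?_ (norm_nonneg _)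
    (norm_one_kronecker_le_one hN k))
  exact (Matrix.l2_opNorm_mul _ _).trans (mul_le_one₀
    (norm_one_kronecker_kronecker_one_le_one hN k) (norm_nonneg _) hP)

/-- The extended adjoint acts blockwise on the rows indexed by the auxiliary system. -/
theorem chAdj_submatrix {dR dE : ℕ}
    (P : Matrix (Fin dR × Fin dB × Fin dE) (Fin dR × Fin dB) ℂ) (e : Fin dE) :
    (chAdj N P).submatrix (fun i : Fin dR × Fin dA => (i.1, i.2, e)) id =
      ∑ k, ((1 : Matrix (Fin dR) (Fin dR) ℂ) ⊗ₖ N k)ᴴ *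
        P.submatrix (fun i : Fin dR × Fin dB => (i.1, i.2, e)) id *
        ((1 : Matrix (Fin dR) (Fin dR) ℂ) ⊗ₖ N k) := by
  ext i j
  simp only [chAdj, Matrix.submatrix_apply, Matrix.sum_apply, id]
  refine Finset.sum_congr rfl fun k _ => ?_
  rw [Matrix.mul_apply, Matrix.mul_apply]
  refine Finset.sum_congr rfl fun x _ => ?_
  congr 1
  simp [Matrix.mul_apply, Fintype.sum_prod_type, Matrix.kroneckerMap_apply, Matrix.one_apply,
    Matrix.conjTranspose_apply, apply_ite (starRingEnd ℂ), eq_comm]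

end Kraus

theorem Matrix.l2_opNorm_le_one_of_add_conjTranspose_mul_self {m n : Type*} [Fintype m]
    [DecidableEq m] [Fintype n] [DecidableEq n] {A B : Matrix m n ℂ}
    (h : Aᴴ * A + Bᴴ * B = 1) : ‖A‖ ≤ 1 ∧ ‖B‖ ≤ 1 := by
  have hAB : ∑ k : Fin 2, (![A, B] k)ᴴ * ![A, B] k = 1 := by simpa using h
  exact ⟨Matrix.l2_opNorm_le_one_of_sum_conjTranspose_mul_self hAB 0,
    Matrix.l2_opNorm_le_one_of_sum_conjTranspose_mul_self hAB 1⟩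

/-- A two-outcome measurement `(L, M)` satisfies `L² + M² ≤ 1`; the defect is written `Qᴴ * Q`. -/
theorem Matrix.PosSemidef.exists_sq_add_sq_add_eq_one {n : Type*} [Fintype n] [DecidableEq n]
    {L M : Matrix n n ℂ} (hL : L.PosSemidef) (hM : M.PosSemidef) (h : L + M = 1) :
    ∃ Q : Matrix n n ℂ, Lᴴ * L + Qᴴ * Q + Mᴴ * M = 1 := by
  have h₁ : (L * M * L).PosSemidef := by
    simpa [hL.isHermitian.eq] using hM.conjTranspose_mul_mul_same L
  have h₂ : (M * L * M).PosSemidef := by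
    simpa [hM.isHermitian.eq] using hL.conjTranspose_mul_mul_same M
  have hpsd := (h₁.add h₂).add (h₁.add h₂)
  obtain ⟨Q, hQ⟩ := CStarAlgebra.nonneg_iff_eq_star_mul_self.mp hpsd.nonneg
  refine ⟨Q, ?_⟩
  rw [← Matrix.star_eq_conjTranspose Q, ← hQ, hL.isHermitian.eq, hM.isHermitian.eq]
  obtain rfl : M = 1 - L := eq_sub_of_add_eq' h
  noncomm_ring

theorem bddAbove_pcoh {dA dB : ℕ} {ι : Type*} [Fintype ι] [DecidableEq ι]
    {N0 N1 : ι → Matrix (Fin dB) (Fin dA) ℂ}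
    (hN0 : ∑ k, (N0 k)ᴴ * N0 k = 1) (hN1 : ∑ k, (N1 k)ᴴ * N1 k = 1) :
    BddAbove {x : ℝ | ∃ (dR dE : ℕ), 0 < dR ∧ 0 < dE ∧
      ∃ P0 P1 : Matrix (Fin dR × Fin dB × Fin dE) (Fin dR × Fin dB) ℂ,
        P0ᴴ * P0 + P1ᴴ * P1 = 1 ∧ x = opNorm (chAdj N0 P0 + chAdj N1 P1)} := by
  refine ⟨Fintype.card ι + Fintype.card ι, ?_⟩
  rintro x ⟨dR, dE, -, -, P0, P1, hP, rfl⟩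
  obtain ⟨h0, h1⟩ := Matrix.l2_opNorm_le_one_of_add_conjTranspose_mul_self hP
  rw [opNorm_eq_norm]
  exact norm_add_le_of_le (norm_chAdj_le hN0 h0) (norm_chAdj_le hN1 h1)

/-- Third inequality of the chain: `p_inc(N⁰,N¹) ≤ √(p_coh(N⁰,N¹))`. -/
theorem pinc_le_sqrt_pcoh {dA dB K : ℕ} (N0 N1 : Fin K → Matrix (Fin dB) (Fin dA) ℂ)
    (hN0 : ∑ k, (N0 k)ᴴ * N0 k = 1) (hN1 : ∑ k, (N1 k)ᴴ * N1 k = 1) :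
    pinc N0 N1 ≤ Real.sqrt (pcoh N0 N1) := by
  rw [pcoh]
  refine le_trans ?_ (Real.le_sqrt_of_sq_le le_rfl)
  refine mul_le_mul_of_nonneg_left ?_ (by norm_num)
  refine Real.sSup_le ?_ (Real.sSup_nonneg ?_)
  · rintro x ⟨dR, hdR, L0, L1, hL0, hL1, hL, rfl⟩
    obtain ⟨Q, hQ⟩ := hL0.exists_sq_add_sq_add_eq_one hL1 hL
    set P0 : Matrix (Fin dR × Fin dB × Fin 2) (Fin dR × Fin dB) ℂ :=
      Matrix.of fun i => ![L0 (i.1, i.2.1), Q (i.1, i.2.1)] i.2.2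
    set P1 : Matrix (Fin dR × Fin dB × Fin 2) (Fin dR × Fin dB) ℂ :=
      Matrix.of fun i => ![L1 (i.1, i.2.1), 0] i.2.2
    have hP : P0ᴴ * P0 + P1ᴴ * P1 = 1 := by
      rw [← hQ]
      ext i j
      simp [P0, P1, Matrix.mul_apply, Fintype.sum_prod_type, Finset.sum_add_distrib]
    refine le_trans ?_ (le_csSup (bddAbove_pcoh hN0 hN1)
      ⟨dR, 2, hdR, two_pos, P0, P1, hP, rfl⟩)
    have hf : Function.Injective fun i : Fin dR × Fin dA => (i.1, i.2, (0 : Fin 2)) :=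
      fun i j h => by simpa [Prod.ext_iff] using h
    have hle := Matrix.l2_opNorm_submatrix_id_le (chAdj N0 P0 + chAdj N1 P1) hf
    rw [Matrix.submatrix_add, Pi.add_apply, Pi.add_apply, chAdj_submatrix, chAdj_submatrix] at hle
    rw [opNorm_eq_norm, opNorm_eq_norm]
    exact hle
  · rintro x ⟨dR, dE, -, -, P0, P1, -, rfl⟩
    exact norm_nonneg _
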